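/- For every real z ≠ 0 and all integers ℓ ≥ p ≥ 0: Σ_{k=p}^{ℓ} (−1)^k (2k+1)(k−p+1)_{2p}·[j_k(z)]² = z²·A_ℓ·[j_ℓ(z)]² + z²·B_ℓ·[j_{ℓ+1}(z)]² + z·C_ℓ·j_ℓ(z)·j_{ℓ+1}(z) + (−1)^p·p!·z^p·j_p(2z), where A_ℓ = (1/2)(−1)^{p+ℓ+1}·p!·Σ_{m=0}^{⌊(p−1)/2⌋} Σ_{n=0}^{p−2m−1} (−1)^{m+n}·(1/(m!·n!))·(m+n+3/2)_{p−2m−n−1}·(p−2m−n)_m·(ℓ−n+2)_{2n}·z^{2m}, B_ℓ is obtained from A_ℓ by replacing ℓ with ℓ−1 (i.e. B_ℓ = (1/2)(−1)^{p+ℓ}·p!·Σ_{m=0}^{⌊(p−1)/2⌋} Σ_{n=0}^{p−2m−1} (−1)^{m+n}·(1/(m!·n!))·(m+n+3/2)_{p−2m−n−1}·(p−2m−n)_m·(ℓ−n+1)_{2n}·z^{2m}), and C_ℓ = (−1)^{p+ℓ}·p!·(ℓ+1)·Σ_{m=0}^{⌊p/2⌋} Σ_{n=0}^{p−2m} (−1)^{m+n}·(1/(m!·n!))·(m+n+1/2)_{p−2m−n}·(p−2m−n+1)_m·(ℓ−n+2)_{2n−1}·z^{2m},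 with ⌊x⌋ the floor function and the convention (f)_{−1} = 1/(f−1). -/

import Mathlib

open Finset

/-- Auxiliary: `sphjAux z n` is the spherical Bessel function `j_{n-1}(z)`. -/
noncomputable def sphjAux (z : ℝ) : ℕ → ℝ
  | 0 => Real.cos z / z
  | 1 => Real.sin z / z
  | (n + 2) => ((2 * (n : ℝ) + 1) / z) * sphjAux z (n + 1) - sphjAux z n

/-- The spherical Bessel function `j_k(z)` for integer `k ≥ -1`. -/
noncomputable def sphj (k : ℤ) (z : ℝ) : ℝ := sphjAux z (k + 1).toNat

/-- The Pochhammer symbol `(f)_n = f (f+1) ⋯ (f+n-1)`, with `(f)_0 = 1`. -/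
noncomputable def poch (f : ℝ) (n : ℕ) : ℝ := ∏ i ∈ Finset.range n, (f + (i : ℝ))

/-- The coefficients `c_m^{(p)} = (2m-p+2)_{2p-2m} / (2^{2p-2m} m! (p-m)!)` for `0 ≤ m ≤ p`,
and `c_m^{(p)} = 0` for `m > p`. -/
noncomputable def cc (p m : ℕ) : ℝ :=
  if m ≤ p then
    poch (2 * (m : ℝ) - p + 2) (2 * (p - m)) /
      (2 ^ (2 * (p - m)) * (m.factorial : ℝ) * ((p - m).factorial : ℝ))
  else 0

/-- The Pochhammer symbol with integer index, extended by the convention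
`(f)_{-1} = 1/(f-1)`. -/
noncomputable def pochZ (f : ℝ) (n : ℤ) : ℝ :=
  if n = -1 then 1 / (f - 1) else ∏ i ∈ Finset.range n.toNat, (f + (i : ℝ))

/-- Coefficient `A_ℓ^{[3],(p)}(z)` of the third hierarchy; the outer sum runs over
`0 ≤ m ≤ ⌊(p-1)/2⌋` (empty for `p = 0`) and the inner one over `0 ≤ n ≤ p - 2m - 1`. -/
noncomputable def A3 (p ℓ : ℕ) (z : ℝ) : ℝ :=
  (1 / 2) * (-1 : ℝ) ^ (p + ℓ + 1) * (p.factorial : ℝ) *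
    ∑ m ∈ Finset.range ((p + 1) / 2), ∑ n ∈ Finset.range (p - 2 * m),
      (-1 : ℝ) ^ (m + n) * (1 / ((m.factorial : ℝ) * (n.factorial : ℝ))) *
        poch ((m : ℝ) + n + 3 / 2) (p - 2 * m - n - 1) * poch ((p : ℝ) - 2 * m - n) m *
        poch ((ℓ : ℝ) - n + 2) (2 * n) * z ^ (2 * m)

/-- Coefficient `B_ℓ^{[3],(p)}(z)` of the third hierarchy, obtained from `A_ℓ^{[3],(p)}(z)`
by replacing `ℓ` with `ℓ - 1`. -/
noncomputable def B3 (p ℓ : ℕ) (z : ℝ) : ℝ :=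
  (1 / 2) * (-1 : ℝ) ^ (p + ℓ) * (p.factorial : ℝ) *
    ∑ m ∈ Finset.range ((p + 1) / 2), ∑ n ∈ Finset.range (p - 2 * m),
      (-1 : ℝ) ^ (m + n) * (1 / ((m.factorial : ℝ) * (n.factorial : ℝ))) *
        poch ((m : ℝ) + n + 3 / 2) (p - 2 * m - n - 1) * poch ((p : ℝ) - 2 * m - n) m *
        poch ((ℓ : ℝ) - n + 1) (2 * n) * z ^ (2 * m)

/-- Coefficient `C_ℓ^{[3],(p)}(z)` of the third hierarchy; here the Pochhammer index `2n - 1`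
may equal `-1`, where the convention `(f)_{-1} = 1/(f-1)` applies. -/
noncomputable def C3 (p ℓ : ℕ) (z : ℝ) : ℝ :=
  (-1 : ℝ) ^ (p + ℓ) * (p.factorial : ℝ) * ((ℓ : ℝ) + 1) *
    ∑ m ∈ Finset.range (p / 2 + 1), ∑ n ∈ Finset.range (p - 2 * m + 1),
      (-1 : ℝ) ^ (m + n) * (1 / ((m.factorial : ℝ) * (n.factorial : ℝ))) *
        poch ((m : ℝ) + n + 1 / 2) (p - 2 * m - n) * poch ((p : ℝ) - 2 * m - n + 1) m *
        pochZ ((ℓ : ℝ) - n + 2) (2 * (n : ℤ) - 1) * z ^ (2 * m)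


noncomputable def PPx (n : ℕ) (x : ℝ) : ℝ := ∏ i ∈ Finset.range n, (x * (x + 1) - (i : ℝ) * (i + 1))
noncomputable def QQx (n : ℕ) (x : ℝ) : ℝ := ∏ i ∈ Finset.range n, (x ^ 2 - (i : ℝ) ^ 2)

noncomputable def gam (p m n : ℕ) : ℝ :=
  if 2 * m + n ≤ p then
    (-1 : ℝ) ^ (m + n) * (1 / ((m.factorial : ℝ) * (n.factorial : ℝ))) *
      poch ((m : ℝ) + n + 1 / 2) (p - 2 * m - n) * poch ((p : ℝ) - 2 * m - n + 1) m
  else 0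

lemma PPx_succ (n : ℕ) (x : ℝ) : PPx (n+1) x = PPx n x * (x * (x + 1) - (n : ℝ) * (n + 1)) := by
  simp [PPx, prod_range_succ]
lemma QQx_succ (n : ℕ) (x : ℝ) : QQx (n+1) x = QQx n x * (x ^ 2 - (n : ℝ) ^ 2) := by
  simp [QQx, prod_range_succ]
lemma PPx_zero (x : ℝ) : PPx 0 x = 1 := by simp [PPx]
lemma QQx_zero (x : ℝ) : QQx 0 x = 1 := by simp [QQx]
lemma poch_zero' (f : ℝ) : poch f 0 = 1 := by simp [poch]
lemma poch_succ_r (f : ℝ) (n : ℕ) : poch f (n+1) = poch f n * (f + n) := by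
  simp [poch, prod_range_succ]
lemma poch_succ_l (f : ℝ) (n : ℕ) : poch f (n+1) = f * poch (f+1) n := by
  simp only [poch, prod_range_succ']
  rw [mul_comm]; push_cast; simp only [add_zero]; congr 1
  exact prod_congr rfl fun i _ => by ring

lemma poch_PPx (n : ℕ) (x : ℝ) : poch (x - n + 1) (2 * n) = PPx n x := by
  induction n with
  | zero => simp [poch, PPx]
  | succ n ih =>
    rw [PPx_succ, ← ih, show 2 * (n+1) = (2 * n + 1) + 1 by ring, poch_succ_r, poch_succ_l]
    push_cast
    rw [show x - (n + 1) + 1 + 1 = x - n + 1 by ring]; ring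

lemma QQx_a (n : ℕ) (x : ℝ) : QQx (n+1) x = x * (x + n) * PPx n (x-1) := by
  induction n with
  | zero => simp [QQx_succ, QQx_zero, PPx_zero]; ring
  | succ n ih => rw [QQx_succ, ih, PPx_succ]; push_cast; ring
lemma QQx_b (n : ℕ) (x : ℝ) : QQx (n+1) (x-1) = (x-1) * (x - 1 - n) * PPx n (x-1) := by
  induction n with
  | zero => simp [QQx_succ, QQx_zero, PPx_zero]; ring
  | succ n ih => rw [QQx_succ, ih, PPx_succ]; push_cast; ring
lemma PPx_a (n : ℕ) (x : ℝ) : PPx (n+1) x = (x + n) * (x + n + 1) * PPx n (x-1) := by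
  induction n with
  | zero => simp [PPx_succ, PPx_zero]
  | succ n ih => rw [PPx_succ, ih, PPx_succ]; push_cast; ring
lemma PPx_b (n : ℕ) (x : ℝ) : PPx (n+1) (x-2) = (x - 1 - n) * (x - n - 2) * PPx n (x-1) := by
  induction n with
  | zero => simp [PPx_succ, PPx_zero]; ring
  | succ n ih => rw [PPx_succ, ih, PPx_succ]; push_cast; ring

lemma pochZ_QQx (n : ℕ) (x : ℝ) (hx : x ≠ 0) :
    x * pochZ (x - n + 1) (2 * (n : ℤ) - 1) = QQx n x := by
  rcases n with _ | n
  · simp [pochZ, QQx_zero, hx]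
  · have h1 : (2 * ((n + 1 : ℕ) : ℤ) - 1) ≠ -1 := by push_cast; omega
    have h2 : (2 * ((n + 1 : ℕ) : ℤ) - 1).toNat = 2 * n + 1 := by push_cast; omega
    have : pochZ (x - (n + 1 : ℕ) + 1) (2 * ((n + 1 : ℕ) : ℤ) - 1)
        = poch (x - (n + 1 : ℕ) + 1) (2 * n + 1) := by
      rw [pochZ, if_neg h1, h2, poch]
    rw [this, QQx_a, poch_succ_r, ← poch_PPx]
    push_cast
    rw [show x - (n + 1) + 1 = x - 1 - n + 1 by ring]; ring

lemma gam_zero (p m n : ℕ) (h : p < 2 * m + n) : gam p m n = 0 := by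
  rw [gam, if_neg (by omega)]

lemma gam_eq (m n q : ℕ) : gam (2 * m + n + q) m n =
    (-1 : ℝ) ^ (m + n) * (1 / ((m.factorial : ℝ) * (n.factorial : ℝ))) *
      poch ((m : ℝ) + n + 1 / 2) q * poch ((q : ℝ) + 1) m := by
  rw [gam, if_pos (by omega), show 2 * m + n + q - 2 * m - n = q by omega]
  push_cast
  rw [show (2 * m + n + q : ℝ) - 2 * m - n + 1 = q + 1 by ring]

lemma gam_eq' (p m n q : ℕ) (h : p = 2 * m + n + q) : gam p m n =
    (-1 : ℝ) ^ (m + n) * (1 / ((m.factorial : ℝ) * (n.factorial : ℝ))) *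
      poch ((m : ℝ) + n + 1 / 2) q * poch ((q : ℝ) + 1) m := by
  rw [h, gam_eq]

lemma gam_rec (p m n : ℕ) : -2 * ((n:ℝ)+1) * (n+2) * gam p m (n+2) =
    2 * gam p (m+1) n + (n+1) * (2*n+1) * gam p (m+1) (n+1) := by
  have hm : (m.factorial : ℝ) ≠ 0 := by positivity
  have hn : (n.factorial : ℝ) ≠ 0 := by positivity
  have hm1 : (m:ℝ) + 1 ≠ 0 := by positivity
  have hn1 : (n:ℝ) + 1 ≠ 0 := by positivity
  have hn2 : (n:ℝ) + 2 ≠ 0 := by positivity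
  have e2 : ((n+2).factorial : ℝ) = (n+2) * (n+1) * n.factorial := by
    rw [Nat.factorial_succ, Nat.factorial_succ]; push_cast; ring
  have e1 : ((n+1).factorial : ℝ) = (n+1) * n.factorial := by
    rw [Nat.factorial_succ]; push_cast; ring
  have e3 : ((m+1).factorial : ℝ) = (m+1) * m.factorial := by
    rw [Nat.factorial_succ]; push_cast; ring
  rcases lt_or_ge p (2 * m + (n+2)) with h | h
  · rw [gam_zero _ _ _ h, gam_zero _ _ _ (by omega), gam_zero _ _ _ (by omega)]; ring
  obtain ⟨q, hq⟩ := Nat.exists_eq_add_of_le h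
  rw [gam_eq' p m (n+2) q hq, gam_eq' p (m+1) n q (by omega), e2, e3]
  rcases q with _ | r
  · rw [gam_zero _ _ _ (by omega)]
    simp only [poch_zero', poch_succ_r _ m]
    push_cast
    rw [show m + (n+2) = m + n + 2 by ring, show m + 1 + n = m + n + 1 by ring]
    simp only [pow_succ]
    field_simp; ring
  · rw [gam_eq' p (m+1) (n+1) r (by omega), e1, e3]
    push_cast
    rw [poch_succ_r _ r, show (m:ℝ) + 1 + n + 1/2 = m + n + 3/2 by ring, poch_succ_l (m + n + 3/2 : ℝ),
      poch_succ_r (r + 1 + 1 : ℝ), poch_succ_l (r + 1 : ℝ),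
      show (m:ℝ) + n + 3/2 + 1 = m + n + 5/2 by ring,
      show (m:ℝ) + (n+2) + 1/2 = m + n + 5/2 by ring,
      show (m:ℝ) + 1 + (n+1) + 1/2 = m + n + 5/2 by ring,
      show m + (n+2) = m + n + 2 by ring, show m + 1 + n = m + n + 1 by ring,
      show m + 1 + (n+1) = m + n + 2 by ring]
    simp only [pow_succ]
    field_simp; ring

lemma gam_rec0 (p n : ℕ) : 2 * gam p 0 n + ((n:ℝ)+1) * (2*n+1) * gam p 0 (n+1) =
    if n = p then 2 * ((-1:ℝ)^p / p.factorial) else 0 := by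
  have hn : (n.factorial : ℝ) ≠ 0 := by positivity
  have hn1 : (n:ℝ) + 1 ≠ 0 := by positivity
  have e1 : ((n+1).factorial : ℝ) = (n+1) * n.factorial := by
    rw [Nat.factorial_succ]; push_cast; ring
  rcases lt_or_ge p n with h | h
  · rw [gam_zero _ _ _ (by omega), gam_zero _ _ _ (by omega), if_neg (by omega)]; ring
  obtain ⟨q, hq⟩ := Nat.exists_eq_add_of_le h
  rw [gam_eq' p 0 n q (by omega)]
  rcases q with _ | r
  · rw [gam_zero _ _ _ (by omega), if_pos (by omega)]
    have : p = n := by omega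
    subst this
    simp [poch_zero']; ring
  · rw [gam_eq' p 0 (n+1) r (by omega), if_neg (by omega), e1]
    push_cast
    rw [poch_succ_l, show (0:ℝ) + n + 1/2 + 1 = 0 + (n + 1) + 1/2 by ring]
    simp only [poch_zero', pow_succ, zero_add, Nat.factorial_zero, Nat.cast_one]
    field_simp; ring

lemma lom_rec (p m n : ℕ) : gam (p+2) (m+1) n =
    ((p:ℝ) + 3/2) * gam (p+1) (m+1) n - gam p m n := by
  have hm : (m.factorial : ℝ) ≠ 0 := by positivity
  have hn : (n.factorial : ℝ) ≠ 0 := by positivity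
  have hm1 : (m:ℝ) + 1 ≠ 0 := by positivity
  have e3 : ((m+1).factorial : ℝ) = (m+1) * m.factorial := by
    rw [Nat.factorial_succ]; push_cast; ring
  rcases lt_or_ge p (2 * m + n) with h | h
  · rw [gam_zero _ _ _ (by omega), gam_zero _ _ _ (by omega), gam_zero _ _ _ (by omega)]; ring
  obtain ⟨q, hq⟩ := Nat.exists_eq_add_of_le h
  rw [gam_eq' p m n q hq, gam_eq' (p+2) (m+1) n q (by omega), e3]
  rcases q with _ | r
  · rw [gam_zero _ _ _ (by omega)]
    simp only [poch_zero', poch_succ_r _ m]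
    push_cast
    rw [show m + 1 + n = m + n + 1 by ring]
    simp only [pow_succ]
    field_simp; ring
  · rw [gam_eq' (p+1) (m+1) n r (by omega), e3, hq]
    push_cast
    rw [poch_succ_r _ r, show (m:ℝ) + 1 + n + 1/2 = m + n + 3/2 by ring, poch_succ_l (m + n + 1/2 : ℝ),
      poch_succ_r (r + 1 + 1 : ℝ), poch_succ_l (r + 1 : ℝ),
      show (m:ℝ) + n + 1/2 + 1 = m + n + 3/2 by ring,
      show m + 1 + n = m + n + 1 by ring]
    simp only [pow_succ]
    field_simp; ring

lemma lom_rec0 (p n : ℕ) (hn : n ≤ p + 1) : gam (p+2) 0 n = ((p:ℝ) + 3/2) * gam (p+1) 0 n := by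
  obtain ⟨q, hq⟩ := Nat.exists_eq_add_of_le hn
  have hq' : (p:ℝ) + 1 = n + q := by exact_mod_cast hq
  rw [gam_eq' (p+2) 0 n (q+1) (by omega), gam_eq' (p+1) 0 n q (by omega), poch_succ_r]
  rw [show (p:ℝ) + 3/2 = n + q + 1/2 by linarith]
  simp only [poch_zero']
  push_cast
  ring

noncomputable def aa (p : ℕ) (z x : ℝ) : ℝ :=
  ∑ m ∈ range (p+2), (∑ n ∈ range (p+2), -((n:ℝ)+1) * gam p m (n+1) * PPx n x) * z^(2*m)
noncomputable def ccx (p : ℕ) (z x : ℝ) : ℝ :=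
  ∑ m ∈ range (p+2), (∑ n ∈ range (p+2), gam p m n * QQx n x) * z^(2*m)

lemma ccx_diff (p : ℕ) (z x : ℝ) : ccx p z x - ccx p z (x-1) = -(2*x-1) * aa p z (x-1) := by
  rw [ccx, ccx, aa, ← sum_sub_distrib, mul_sum]
  refine sum_congr rfl fun m _ => ?_
  rw [← sub_mul, ← mul_assoc, ← sum_sub_distrib, sum_range_succ', mul_sum, sum_range_succ _ (p+1),
    gam_zero p m (p+1+1) (by omega), QQx_zero, QQx_zero]
  simp only [mul_zero, zero_mul, sub_self, add_zero]
  congr 1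
  refine sum_congr rfl fun n _ => ?_
  rw [QQx_a, QQx_b]; ring

lemma inner_a (p m : ℕ) (x : ℝ) :
    (∑ n ∈ range (p+2), -((n:ℝ)+1) * gam p m (n+1) * PPx n x)
      - (∑ n ∈ range (p+2), -((n:ℝ)+1) * gam p m (n+1) * PPx n (x-2)) =
    (2*x-1) * ∑ n ∈ range (p+2), (-2 * ((n:ℝ)+1) * (n+2) * gam p m (n+2)) * PPx n (x-1) := by
  rw [← sum_sub_distrib, sum_range_succ', mul_sum, sum_range_succ _ (p+1),
    gam_zero p m (p+1+2) (by omega), PPx_zero, PPx_zero]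
  simp only [mul_zero, zero_mul, sub_self, add_zero]
  refine sum_congr rfl fun n _ => ?_
  rw [PPx_a, PPx_b, show n + 1 + 1 = n + 2 by ring]; push_cast; ring

lemma inner_c (p m : ℕ) (x : ℝ) :
    (∑ n ∈ range (p+2), gam p m n * QQx n x) + (∑ n ∈ range (p+2), gam p m n * QQx n (x-1)) =
    ∑ n ∈ range (p+2), (2 * gam p m n + ((n:ℝ)+1) * (2*n+1) * gam p m (n+1)) * PPx n (x-1) := by
  have h : ∑ n ∈ range (p+2), (2 * gam p m n + ((n:ℝ)+1) * (2*n+1) * gam p m (n+1)) * PPx n (x-1)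
     = ∑ n ∈ range (p+2), 2 * gam p m n * PPx n (x-1)
      + ∑ n ∈ range (p+2), ((n:ℝ)+1) * (2*n+1) * gam p m (n+1) * PPx n (x-1) := by
    rw [← sum_add_distrib]; exact sum_congr rfl fun n _ => by ring
  rw [h, ← sum_add_distrib, sum_range_succ', sum_range_succ' _ (p+1),
    sum_range_succ (fun n : ℕ => ((n:ℝ)+1) * (2*n+1) * gam p m (n+1) * PPx n (x-1)) (p+1),
    gam_zero p m (p+1+1) (by omega), PPx_zero, QQx_zero, QQx_zero, mul_zero, zero_mul, add_zero,
    add_right_comm, ← sum_add_distrib]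
  congr 1
  · refine sum_congr rfl fun n _ => ?_
    rw [QQx_a, QQx_b, PPx_succ]; ring
  · ring

lemma aa_diff (p : ℕ) (z x : ℝ) : z^2 * (aa p z x - aa p z (x-2)) =
    (2*x-1) * (ccx p z x + ccx p z (x-1) - 2 * ((-1:ℝ)^p / p.factorial) * PPx p (x-1)) := by
  have hc : ccx p z x + ccx p z (x-1) = ∑ m ∈ range (p+2),
      (∑ n ∈ range (p+2), (2 * gam p m n + ((n:ℝ)+1) * (2*n+1) * gam p m (n+1)) * PPx n (x-1))
        * z^(2*m) := by
    rw [ccx, ccx, ← sum_add_distrib]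
    exact sum_congr rfl fun m _ => by rw [← inner_c]; ring
  have ha : aa p z x - aa p z (x-2) = (2*x-1) * ∑ m ∈ range (p+2),
      (∑ n ∈ range (p+2), (-2 * ((n:ℝ)+1) * (n+2) * gam p m (n+2)) * PPx n (x-1)) * z^(2*m) := by
    rw [aa, aa, ← sum_sub_distrib, mul_sum]
    exact sum_congr rfl fun m _ => by rw [← mul_assoc, ← inner_a]; ring
  have h0 : (∑ n ∈ range (p+2), (2 * gam p 0 n + ((n:ℝ)+1) * (2*n+1) * gam p 0 (n+1)) * PPx n (x-1))
      = 2 * ((-1:ℝ)^p / p.factorial) * PPx p (x-1) := by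
    simp only [gam_rec0, ite_mul, zero_mul]
    rw [sum_ite_eq' (range (p+2)) p, if_pos (by simp)]
  have htop : (∑ n ∈ range (p+2), (-2 * ((n:ℝ)+1) * (n+2) * gam p (p+1) (n+2)) * PPx n (x-1)) = 0 :=
    sum_eq_zero fun n _ => by rw [gam_zero _ _ _ (by omega)]; ring
  rw [hc, ha, sum_range_succ, htop, sum_range_succ' _ (p+1), h0]
  simp only [gam_rec, mul_zero, pow_zero, zero_mul, add_zero, mul_one, add_sub_cancel_right]
  rw [mul_left_comm, mul_sum]
  congr 1
  exact sum_congr rfl fun m _ => by rw [show 2 * (m+1) = 2 * m + 2 by ring, pow_add]; ring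

noncomputable def lomS (p n : ℕ) (z : ℝ) : ℝ := ∑ m ∈ range (p+2), gam p m n * z^(2*m)

lemma lomS_ext (p n M : ℕ) (z : ℝ) (h : p + 2 ≤ M) :
    lomS p n z = ∑ m ∈ range M, gam p m n * z^(2*m) := by
  refine sum_subset (by simpa using h) fun m _ hm => ?_
  rw [gam_zero _ _ _ (by simp at hm; omega), zero_mul]

lemma lomS_rec (p n : ℕ) (z : ℝ) (hn : n ≤ p + 1) :
    lomS (p+2) n z = ((p:ℝ) + 3/2) * lomS (p+1) n z - z^2 * lomS p n z := by
  rw [lomS_ext (p+1) n (p+3+1) z (by omega), lomS_ext p n (p+3) z (by omega), lomS,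
    sum_range_succ', sum_range_succ' _ (p+3), lom_rec0 p n hn, mul_add, mul_sum, mul_sum,
    add_sub_right_comm, ← sum_sub_distrib]
  congr 1
  · exact sum_congr rfl fun m _ => by
      rw [lom_rec, show 2 * (m+1) = 2 * m + 2 by ring, pow_add]; ring
  · ring

lemma sphjAux_succ (z : ℝ) (n : ℕ) :
    sphjAux z (n+2) = ((2 * (n : ℝ) + 1) / z) * sphjAux z (n + 1) - sphjAux z n := rfl

lemma base_formula (z : ℝ) (hz : z ≠ 0) (p : ℕ) : z^p * sphjAux (2*z) (p+1) =
    lomS p 0 z * (Real.sin (2*z) / (2*z)) + 1/2 * lomS p 1 z * Real.cos (2*z) := by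
  induction p using Nat.strong_induction_on with
  | _ p ih =>
    rcases p with _ | _ | p
    · simp [lomS, sum_range_succ, gam, poch, sphjAux]
    · simp [lomS, sum_range_succ, gam, poch, sphjAux]
      field_simp
      try ring
    · have h1 := ih p (by omega)
      have h2 := ih (p+1) (by omega)
      rw [lomS_rec p 0 z (by omega), lomS_rec p 1 z (by omega), sphjAux_succ]
      have : z^(p+2) * ((2 * ((p+1:ℕ) : ℝ) + 1) / (2*z) * sphjAux (2*z) (p+1+1) - sphjAux (2*z) (p+1))
        = ((p:ℝ)+3/2) * (z^(p+1) * sphjAux (2*z) (p+1+1)) - z^2 * (z^p * sphjAux (2*z) (p+1)) := by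
        push_cast; field_simp; ring
      rw [this, h1, h2]; ring

lemma QQx_at0 (n : ℕ) : QQx (n+1) 0 = 0 := by rw [QQx_a]; ring
lemma PPx_at0 (n : ℕ) : PPx (n+1) 0 = 0 := prod_eq_zero (i := 0) (by simp) (by simp)
lemma PPx_atm (n : ℕ) : PPx (n+1) (-1) = 0 := prod_eq_zero (i := 0) (by simp) (by simp)

lemma ccx_at0 (p : ℕ) (z : ℝ) : ccx p z 0 = lomS p 0 z := by
  refine sum_congr rfl fun m _ => ?_
  rw [sum_range_succ', sum_eq_zero (fun n _ => by rw [QQx_at0, mul_zero]), QQx_zero]; ring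
lemma aa_at0 (p : ℕ) (z : ℝ) : aa p z 0 = -lomS p 1 z := by
  rw [lomS, ← sum_neg_distrib]
  refine sum_congr rfl fun m _ => ?_
  rw [sum_range_succ', sum_eq_zero (fun n _ => by rw [PPx_at0, mul_zero]), PPx_zero]; simp
lemma aa_atm (p : ℕ) (z : ℝ) : aa p z (-1) = -lomS p 1 z := by
  rw [lomS, ← sum_neg_distrib]
  refine sum_congr rfl fun m _ => ?_
  rw [sum_range_succ', sum_eq_zero (fun n _ => by rw [PPx_atm, mul_zero]), PPx_zero]; simp

lemma main_tel (z : ℝ) (hz : z ≠ 0) (p N : ℕ) :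
    ∑ k ∈ range N, (-1:ℝ)^k * (2*(k:ℝ)+1) * PPx p k * sphjAux z (k+1) ^ 2 =
    (-1:ℝ)^(p+N) * p.factorial * (1/2 * z^2 * aa p z N * sphjAux z N ^ 2
      - 1/2 * z^2 * aa p z (N-1) * sphjAux z (N+1) ^ 2
      - z * ccx p z N * sphjAux z N * sphjAux z (N+1))
    + (-1:ℝ)^p * p.factorial * z^p * sphjAux (2*z) (p+1) := by
  induction N with
  | zero =>
    have h := base_formula z hz p
    rw [mul_assoc _ (z^p), h]
    simp only [range_zero, sum_empty, Nat.cast_zero, add_zero, zero_sub, ccx_at0, aa_at0, aa_atm,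
      sphjAux, zero_add, Real.sin_two_mul, Real.cos_two_mul']
    field_simp
    ring
  | succ N ih =>
    rw [sum_range_succ, ih, sphjAux_succ]
    have h1 := ccx_diff p z (N+1)
    have h2 := aa_diff p z (N+1)
    rw [show (N:ℝ) + 1 - 1 = N by ring] at h1 h2
    rw [show (N:ℝ) + 1 - 2 = N - 1 by ring] at h2
    push_cast
    rw [show (N:ℝ) + 1 - 1 = N by ring]
    have hf : (p.factorial : ℝ) ≠ 0 := by positivity
    have hs : ((-1:ℝ)^p)^2 = 1 := by rw [← pow_mul, mul_comm, pow_mul]; simp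
    have h1' : ccx p z (N+1) = ccx p z N - (2*N+1) * aa p z N := by linear_combination h1
    rw [h1'] at h2
    rw [h1', ← add_assoc p N 1, pow_succ (-1:ℝ) (p+N), pow_add]
    generalize aa p z (N+1) = a2 at *
    generalize aa p z N = a1 at *
    generalize aa p z (N-1) = a0 at *
    generalize ccx p z N = c at *
    generalize sphjAux z (N+1) = u at *
    generalize sphjAux z N = v at *
    generalize PPx p N = P at *
    generalize (-1:ℝ)^p = s at *
    generalize (-1:ℝ)^N = t at *
    field_simp
    field_simp at h2
    linear_combination (s * t * u^2) * h2 - 2 * t * (2*N+1) * P * u^2 * hs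

lemma sum_ext (p : ℕ) (M : ℕ) (K : ℕ → ℕ) (f g : ℕ → ℕ → ℝ) (hM : M ≤ p + 2)
    (hK : ∀ m, K m ≤ p + 2)
    (hfg : ∀ m n, m < M → n < K m → f m n = g m n)
    (h0 : ∀ m n, M ≤ m → g m n = 0) (h1 : ∀ m n, K m ≤ n → g m n = 0) :
    ∑ m ∈ range M, ∑ n ∈ range (K m), f m n = ∑ m ∈ range (p+2), ∑ n ∈ range (p+2), g m n := by
  rw [← sum_subset (s₁ := range M) (by simpa using hM)
    (fun m _ hm => sum_eq_zero fun n _ => h0 m n (by simpa using hm))]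
  refine sum_congr rfl fun m hm => ?_
  rw [← sum_subset (s₁ := range (K m)) (by simpa using hK m)
    (fun n _ hn => h1 m n (by simpa using hn))]
  exact sum_congr rfl fun n hn => hfg m n (by simpa using hm) (by simpa using hn)

lemma bridge_a (p : ℕ) (z x : ℝ) : ∑ m ∈ Finset.range ((p + 1) / 2), ∑ n ∈ Finset.range (p - 2 * m),
      (-1 : ℝ) ^ (m + n) * (1 / ((m.factorial : ℝ) * (n.factorial : ℝ))) *
        poch ((m : ℝ) + n + 3 / 2) (p - 2 * m - n - 1) * poch ((p : ℝ) - 2 * m - n) m *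
        poch (x - n + 1) (2 * n) * z ^ (2 * m) = aa p z x := by
  simp only [aa, sum_mul]
  refine sum_ext p _ (fun m => p - 2 * m) _ _ (by omega) (fun m => by omega) ?_ ?_ ?_
  · intro m n hm hn
    have hn' : n < p - 2 * m := hn
    rw [gam, if_pos (by omega), poch_PPx, show p - 2 * m - (n+1) = p - 2 * m - n - 1 by omega,
      Nat.factorial_succ]
    have hf : (n.factorial : ℝ) ≠ 0 := by positivity
    have hf' : (m.factorial : ℝ) ≠ 0 := by positivity
    have hn1 : (n:ℝ) + 1 ≠ 0 := by positivity
    push_cast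
    rw [show (m:ℝ) + (n+1) + 1/2 = m + n + 3/2 by ring,
      show (p:ℝ) - 2 * m - (n+1) + 1 = p - 2 * m - n by ring, ← add_assoc, pow_succ]
    field_simp
  · intro m n hm
    rw [gam_zero _ _ _ (by omega)]; ring
  · intro m n hn
    have hn' : p - 2 * m ≤ n := hn
    rw [gam_zero _ _ _ (by omega)]; ring

lemma bridge_c (p : ℕ) (z x : ℝ) (hx : x ≠ 0) :
   x * ∑ m ∈ Finset.range (p / 2 + 1), ∑ n ∈ Finset.range (p - 2 * m + 1),
      (-1 : ℝ) ^ (m + n) * (1 / ((m.factorial : ℝ) * (n.factorial : ℝ))) *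
        poch ((m : ℝ) + n + 1 / 2) (p - 2 * m - n) * poch ((p : ℝ) - 2 * m - n + 1) m *
        pochZ (x - n + 1) (2 * (n : ℤ) - 1) * z ^ (2 * m) = ccx p z x := by
  simp only [ccx, sum_mul, mul_sum]
  refine sum_ext p _ (fun m => p - 2 * m + 1) _ _ (by omega) (fun m => by omega) ?_ ?_ ?_
  · intro m n hm hn
    have hn' : n < p - 2 * m + 1 := hn
    rw [gam, if_pos (by omega), ← pochZ_QQx n x hx]
    ring
  · intro m n hm
    rw [gam_zero _ _ _ (by omega)]; ring
  · intro m n hn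
    have hn' : p - 2 * m + 1 ≤ n := hn
    rw [gam_zero _ _ _ (by omega)]; ring

lemma A3_eq (p ℓ : ℕ) (z : ℝ) : A3 p ℓ z =
    (1 / 2) * (-1 : ℝ) ^ (p + ℓ + 1) * (p.factorial : ℝ) * aa p z (ℓ+1) := by
  rw [A3, ← bridge_a]
  simp only [show ∀ n : ℕ, (ℓ:ℝ) + 1 - n + 1 = ℓ - n + 2 from fun n => by ring]

lemma B3_eq (p ℓ : ℕ) (z : ℝ) : B3 p ℓ z =
    (1 / 2) * (-1 : ℝ) ^ (p + ℓ) * (p.factorial : ℝ) * aa p z ℓ := by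
  rw [B3, ← bridge_a]

lemma C3_eq (p ℓ : ℕ) (z : ℝ) : C3 p ℓ z =
    (-1 : ℝ) ^ (p + ℓ) * (p.factorial : ℝ) * ccx p z (ℓ+1) := by
  rw [C3, ← bridge_c _ _ _ (by positivity), ← mul_assoc]
  simp only [show ∀ n : ℕ, (ℓ:ℝ) + 1 - n + 1 = ℓ - n + 2 from fun n => by ring]

lemma PPx_vanish (p k : ℕ) (h : k < p) : PPx p k = 0 :=
  prod_eq_zero (i := k) (by simpa using h) (by ring)

lemma sphj_nat (k : ℕ) (z : ℝ) : sphj (k:ℤ) z = sphjAux z (k+1) := by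
  rw [sphj]; congr 1

/-- The third hierarchy of sum rules. -/
theorem third_hierarchy_sum_rule (z : ℝ) (hz : z ≠ 0) (p ℓ : ℕ) (hpℓ : p ≤ ℓ) :
    ∑ k ∈ Finset.Icc p ℓ,
        (-1 : ℝ) ^ k * (2 * (k : ℝ) + 1) * poch ((k : ℝ) - p + 1) (2 * p) * (sphj k z) ^ 2 =
      z ^ 2 * A3 p ℓ z * (sphj ℓ z) ^ 2 + z ^ 2 * B3 p ℓ z * (sphj (ℓ + 1) z) ^ 2 +
        z * C3 p ℓ z * sphj ℓ z * sphj (ℓ + 1) z +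
        (-1 : ℝ) ^ p * (p.factorial : ℝ) * z ^ p * sphj p (2 * z) := by
  have hN : sphj ((ℓ:ℤ)+1) z = sphjAux z (ℓ+1+1) := by
    rw [← sphj_nat]; push_cast; rfl
  have h := main_tel z hz p (ℓ+1)
  have hL : ∑ k ∈ Finset.Icc p ℓ,
        (-1 : ℝ) ^ k * (2 * (k : ℝ) + 1) * poch ((k : ℝ) - p + 1) (2 * p) * (sphj k z) ^ 2
      = ∑ k ∈ range (ℓ+1), (-1:ℝ)^k * (2*(k:ℝ)+1) * PPx p k * sphjAux z (k+1) ^ 2 := by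
    simp only [poch_PPx, sphj_nat]
    refine sum_subset (fun k hk => by simp at hk ⊢; omega) fun k hk hk' => ?_
    rw [PPx_vanish p k (by simp at hk hk'; omega)]; ring
  rw [hL, h, A3_eq, B3_eq, C3_eq, hN, sphj_nat, sphj_nat]
  push_cast
  rw [add_sub_cancel_right, ← add_assoc, pow_succ]
  ring
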